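/- Let G be a finite group, n ≥ 1, k ≥ 1 with k ≤ n, and c a conjugacy class of G. Then a_{k,c}, viewed as a class function on G ≀ S_n, lies in the ℂ-linear span of the functions (Ind φ)^{(m)} for m ≤ k and φ ranging over the irreducible characters of G. -/

import Mathlib

/-- The permutation `σ` acts on tuples `Fin n → G` by `(σ • v) i = v (σ⁻¹ i)`. -/
def permMulAut (G : Type) [Group G] {n : ℕ} (σ : Equiv.Perm (Fin n)) :
    MulAut (Fin n → G) :=
  { Equiv.arrowCongr σ (Equiv.refl G) with
    map_mul' := fun _ _ => rfl }

/-- The action homomorphism defining the wreath product `G ≀ Sₙ`. -/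
def wreathAction (G : Type) [Group G] (n : ℕ) :
    Equiv.Perm (Fin n) →* MulAut (Fin n → G) where
  toFun := permMulAut G
  map_one' := by
    ext v i
    rfl
  map_mul' := fun σ τ => by
    ext v i
    rfl

/-- The wreath product `G ≀ Sₙ = Gⁿ ⋊ Sₙ`. -/
abbrev Wr (G : Type) [Group G] (n : ℕ) :=
  SemidirectProduct (Fin n → G) (Equiv.Perm (Fin n)) (wreathAction G n)

instance (G : Type) [Group G] [Fintype G] (n : ℕ) : Fintype (Wr G n) :=
  Fintype.ofEquiv ((Fin n → G) × Equiv.Perm (Fin n))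
    { toFun := fun p => ⟨p.1, p.2⟩
      invFun := fun x => (x.left, x.right)
      left_inv := fun _ => rfl
      right_inv := fun _ => rfl }

/-- The product `v(i_t)⋯v(i_1)` along the `σ`-cycle starting at `i = i_1`. -/
def cycleProd {G : Type} [Group G] {n : ℕ} (t : ℕ) (v : Fin n → G)
    (σ : Equiv.Perm (Fin n)) (i : Fin n) : G :=
  (((List.range t).reverse).map fun ℓ => v ((σ ^ ℓ) i)).prod

/-- `a_{t,c}(v,σ)`: the number of `t`-cycles of `σ` whose cycle product lies in the
conjugacy class `c` of `G`. -/
noncomputable def aTC {G : Type} [Group G] {n : ℕ} (t : ℕ) (c : ConjClasses G)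
    (v : Fin n → G) (σ : Equiv.Perm (Fin n)) : ℕ :=
  Nat.card {i : Fin n // (σ ^ t) i = i ∧ (∀ s, 0 < s → s < t → (σ ^ s) i ≠ i) ∧
    ConjClasses.mk (cycleProd t v σ i) = c} / t

open CategoryTheory

section Characters

variable {k G V : Type*} [Field k] [Group G] [Fintype G] [AddCommGroup V] [Module k V]

lemma Representation.trace_asAlgebraHom (ρ : Representation k G V) (z : MonoidAlgebra k G) :
    LinearMap.trace k V (ρ.asAlgebraHom z) = ∑ g, z.coeff g * ρ.character g := by
  rw [Representation.asAlgebraHom_def, MonoidAlgebra.lift_apply, Finsupp.sum_fintype _ _ (by simp)]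
  simp [Representation.character]

/-- A central element of the group algebra whose trace on an irreducible representation vanishes
acts as zero on it. -/
lemma Representation.IsIrreducible.asAlgebraHom_eq_zero [IsAlgClosed k] [CharZero k]
    [FiniteDimensional k V] (ρ : Representation k G V) [hρ : ρ.IsIrreducible]
    {z : MonoidAlgebra k G} (hz : ∀ y, z * y = y * z)
    (h : ∑ g, z.coeff g * ρ.character g = 0) : ρ.asAlgebraHom z = 0 := by
  have : Nontrivial V := by
    by_contra hV
    rw [not_nontrivial_iff_subsingleton] at hV
    exact bot_ne_top (α := Subrepresentation ρ) (by ext v; simp [Subsingleton.elim v 0])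
  let f : Representation.IntertwiningMap ρ ρ :=
    { toLinearMap := ρ.asAlgebraHom z
      isIntertwining' := fun g ↦ by
        rw [← ρ.asAlgebraHom_of, ← Module.End.mul_eq_comp, ← Module.End.mul_eq_comp,
          ← map_mul, ← map_mul, hz] }
  obtain ⟨c, hc⟩ :=
    (Representation.IsIrreducible.algebraMap_intertwiningMap_bijective_of_isAlgClosed (ρ := ρ)).2 f
  have hc' : ρ.asAlgebraHom z = c • LinearMap.id := by
    ext v
    exact (congrArg (fun f : Representation.IntertwiningMap ρ ρ ↦ f v) hc).symm
  rw [← ρ.trace_asAlgebraHom, hc', map_smul, LinearMap.trace_id, smul_eq_mul, mul_eq_zero,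
    Nat.cast_eq_zero] at h
  rw [hc', h.resolve_right Module.finrank_pos.ne', zero_smul]

lemma FDRep.simple_of_isIrreducible {k G V : Type} [Field k] [IsAlgClosed k] [CharZero k]
    [Group G] [Fintype G] [AddCommGroup V] [Module k V] [FiniteDimensional k V]
    (ρ : Representation k G V) [ρ.IsIrreducible] : Simple (FDRep.of ρ) := by
  have := invertibleOfNonzero (NeZero.ne (Nat.card G : k))
  have h := Representation.char_orthonormal ρ ρ
  rw [if_pos ⟨.refl _⟩, inv_mul_eq_one₀ (NeZero.ne _)] at h
  exact (FDRep.simple_iff_char_is_norm_one _).2 h.symm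

end Characters

lemma Representation.ofModule'_asAlgebraHom_apply {k G M : Type*} [CommSemiring k] [Monoid G]
    [AddCommMonoid M] [Module k M] [Module (MonoidAlgebra k G) M]
    [IsScalarTower k (MonoidAlgebra k G) M] (z : MonoidAlgebra k G) (m : M) :
    (Representation.ofModule' (k := k) (G := G) M).asAlgebraHom z m = z • m := by
  have : (Representation.ofModule' (k := k) (G := G) M).asAlgebraHom =
      Algebra.lsmul k k M := (MonoidAlgebra.lift k (Module.End k M) G).apply_symm_apply _
  rw [this, Algebra.lsmul_coe]

lemma Representation.isIrreducible_ofModule' {k G M : Type*} [Field k] [Monoid G]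
    [AddCommGroup M] [Module k M] [Module (MonoidAlgebra k G) M]
    [IsScalarTower k (MonoidAlgebra k G) M] [IsSimpleModule (MonoidAlgebra k G) M] :
    (Representation.ofModule' (k := k) (G := G) M).IsIrreducible := by
  rw [Representation.irreducible_iff_isSimpleModule_asModule]
  let ρ := Representation.ofModule' (k := k) (G := G) M
  let e : ρ.asModule ≃ₗ[MonoidAlgebra k G] M :=
    { ρ.asModuleEquiv.toAddEquiv with
      map_smul' := fun z m ↦ (ρ.asModuleEquiv_map_smul z m).trans
        (Representation.ofModule'_asAlgebraHom_apply z _) }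
  exact IsSimpleModule.congr e

lemma MonoidAlgebra.smul_eq_zero_of_isSimpleModule {G M : Type} [Group G] [Fintype G]
    {z : MonoidAlgebra ℂ G} (hz : ∀ y, z * y = y * z)
    (h : ∀ V : FDRep ℂ G, Simple V → ∑ g, z.coeff g * V.character g = 0)
    [AddCommGroup M] [Module ℂ M] [Module (MonoidAlgebra ℂ G) M]
    [IsScalarTower ℂ (MonoidAlgebra ℂ G) M] [IsSimpleModule (MonoidAlgebra ℂ G) M]
    (m : M) : z • m = 0 := by
  have := Representation.isIrreducible_ofModule' (k := ℂ) (G := G) (M := M)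
  have : FiniteDimensional ℂ M := Module.Finite.trans (MonoidAlgebra ℂ G) M
  let ρ := Representation.ofModule' (k := ℂ) (G := G) M
  rw [← Representation.ofModule'_asAlgebraHom_apply,
    Representation.IsIrreducible.asAlgebraHom_eq_zero ρ hz
      (h (FDRep.of ρ) (FDRep.simple_of_isIrreducible ρ)), LinearMap.zero_apply]

lemma MonoidAlgebra.eq_zero_of_sum_mul_character_eq_zero {G : Type} [Group G] [Fintype G]
    {z : MonoidAlgebra ℂ G} (hz : ∀ y, z * y = y * z)
    (h : ∀ V : FDRep ℂ G, Simple V → ∑ g, z.coeff g * V.character g = 0) : z = 0 := by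
  have key : sSup {S : Submodule (MonoidAlgebra ℂ G) (MonoidAlgebra ℂ G) |
      IsSimpleModule (MonoidAlgebra ℂ G) S} ≤
      LinearMap.ker (LinearMap.toSpanSingleton (MonoidAlgebra ℂ G) (MonoidAlgebra ℂ G) z) := by
    refine sSup_le fun S hS s hs ↦ ?_
    have : IsSimpleModule (MonoidAlgebra ℂ G) S := hS
    rw [LinearMap.mem_ker, LinearMap.toSpanSingleton_apply, smul_eq_mul, ← hz]
    exact congrArg Subtype.val
      (MonoidAlgebra.smul_eq_zero_of_isSimpleModule hz h (⟨s, hs⟩ : S))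
  rw [IsSemisimpleModule.sSup_simples_eq_top] at key
  simpa using key (Submodule.mem_top (x := 1))

/-- The irreducible characters span the class functions. -/
lemma FDRep.mem_span_character_of_conj_invariant {G : Type} [Group G] [Fintype G] {f : G → ℂ}
    (hf : ∀ g h, f (h * g * h⁻¹) = f g) :
    f ∈ Submodule.span ℂ {χ : G → ℂ | ∃ V : FDRep ℂ G, Simple V ∧ χ = V.character} := by
  classical
  by_contra hf'
  obtain ⟨ℓ, hℓ, hle⟩ := Submodule.exists_le_ker_of_notMem hf'
  let b : G → ℂ := fun g ↦ ∑ h, ℓ (Pi.single (h * g * h⁻¹) 1)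
  have hb (g h : G) : b (h * g * h⁻¹) = b g :=
    Fintype.sum_equiv (Equiv.mulRight h) _ _ fun x ↦ by simp [mul_assoc]
  have hsum (e : G → ℂ) (he : ∀ g h, e (h * g * h⁻¹) = e g) :
      ∑ g, b g * e g = Fintype.card G * ℓ e := by
    simp only [b, Finset.sum_mul]
    rw [Finset.sum_comm]
    have (h : G) : ∑ g, ℓ (Pi.single (h * g * h⁻¹) 1) * e g = ℓ e := by
      rw [LinearMap.pi_apply_eq_sum_univ ℓ e]
      refine Fintype.sum_equiv (MulAut.conj h).toEquiv _ _ fun g ↦ ?_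
      simp only [MulEquiv.toEquiv_eq_coe, EquivLike.coe_coe, MulAut.conj_apply, he, smul_eq_mul]
      rw [mul_comm]
      congr 2
      ext i
      simp [Pi.single_apply, eq_comm]
    simp [this]
  let z : MonoidAlgebra ℂ G := MonoidAlgebra.ofCoeff (Finsupp.equivFunOnFinite.symm b)
  have hzb (g : G) : z.coeff g = b g := rfl
  have hz : z = 0 := by
    refine MonoidAlgebra.eq_zero_of_sum_mul_character_eq_zero (fun y ↦ ?_) fun V hV ↦ ?_
    · induction y using MonoidAlgebra.induction_on with
      | of g =>
        ext x
        rw [MonoidAlgebra.of_apply, MonoidAlgebra.coeff_mul_single_apply,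
          MonoidAlgebra.coeff_single_mul_apply, mul_one, one_mul, hzb, hzb, ← hb _ g⁻¹]
        simp [mul_assoc]
      | add x y hx hy => rw [mul_add, add_mul, hx, hy]
      | smul r x hx => rw [mul_smul_comm, smul_mul_assoc, hx]
    · simp only [hzb]
      rw [hsum _ fun g h ↦ V.char_conj g h,
        LinearMap.mem_ker.1 (hle (Submodule.subset_span ⟨V, hV, rfl⟩)),
        mul_zero]
  refine hℓ ?_
  have := hsum f hf
  simp only [← hzb, hz] at this
  simpa using this

section Wreath

variable {G : Type} [Group G] {n : ℕ}

lemma Wr.mul_left_apply (x y : Wr G n) (i : Fin n) :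
    (x * y).left i = x.left i * y.left (x.right⁻¹ i) := rfl

lemma Wr.pow_right (x : Wr G n) (m : ℕ) : (x ^ m).right = x.right ^ m :=
  map_pow SemidirectProduct.rightHom x m

lemma Wr.pow_left_of_fixed (x : Wr G n) {i : Fin n} (hi : x.right i = i) (j : ℕ) :
    (x ^ j).left i = x.left i ^ j := by
  induction j with
  | zero => simp
  | succ j ih =>
    rw [pow_succ', pow_succ', Wr.mul_left_apply, Equiv.Perm.inv_eq_iff_eq.2 hi.symm, ih]

lemma cycleProd_succ (t : ℕ) (v : Fin n → G) (σ : Equiv.Perm (Fin n)) (i : Fin n) :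
    cycleProd (t + 1) v σ i = v ((σ ^ t) i) * cycleProd t v σ i := by
  simp [cycleProd, List.range_succ]

lemma Wr.pow_left_apply_pow (x : Wr G n) (t : ℕ) (i : Fin n) :
    (x ^ t).left ((x.right ^ t) i) = cycleProd t x.left x.right (x.right i) := by
  induction t with
  | zero => rfl
  | succ t ih =>
    rw [pow_succ' x, Wr.mul_left_apply, cycleProd_succ, ← ih, pow_succ' x.right,
      Equiv.Perm.mul_apply, Equiv.Perm.inv_def, Equiv.symm_apply_apply,
      ← Equiv.Perm.mul_apply, ← Equiv.Perm.mul_apply,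
      ← pow_succ, ← pow_succ']

lemma Wr.isConj_pow_left (x : Wr G n) {t : ℕ} {i : Fin n} (hi : (x.right ^ t) i = i) :
    IsConj ((x ^ t).left i) ((x ^ t).left (x.right i)) := by
  have h := congrArg (fun y : Wr G n ↦ y.left (x.right i))
    ((pow_succ x t).symm.trans (pow_succ' x t))
  have hi' : (x.right ^ t) (x.right i) = x.right i := by
    rw [← Equiv.Perm.mul_apply, ← pow_succ, pow_succ', Equiv.Perm.mul_apply, hi]
  have hx : x.right⁻¹ (x.right i) = i := x.right.symm_apply_apply i
  simp only [Wr.mul_left_apply, Wr.pow_right] at h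
  rw [Equiv.Perm.inv_eq_iff_eq.2 hi'.symm, hx] at h
  rw [isConj_iff]
  exact ⟨x.left (x.right i), by rw [← h, mul_inv_cancel_right]⟩

lemma Wr.mk_cycleProd (x : Wr G n) {t : ℕ} {i : Fin n} (hi : (x.right ^ t) i = i) :
    ConjClasses.mk (cycleProd t x.left x.right i) = ConjClasses.mk ((x ^ t).left i) := by
  obtain ⟨j, rfl⟩ := x.right.surjective i
  have hj : (x.right ^ t) j = j := x.right.injective <| by
    rw [← Equiv.Perm.mul_apply, ← pow_succ', pow_succ, Equiv.Perm.mul_apply, hi]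
  rw [← Wr.pow_left_apply_pow, hj]
  exact ConjClasses.mk_eq_mk_iff_isConj.2 (x.isConj_pow_left hj)

lemma Equiv.Perm.minimalPeriod_eq_iff {α : Type*} (σ : Equiv.Perm α) {t : ℕ} (ht : 0 < t) (i : α) :
    Function.minimalPeriod σ i = t ↔ (σ ^ t) i = i ∧ ∀ s, 0 < s → s < t → (σ ^ s) i ≠ i := by
  have hp (s : ℕ) : (σ ^ s) i = i ↔ Function.IsPeriodicPt σ s i := by
    rw [← Equiv.Perm.iterate_eq_pow]; rfl
  constructor
  · rintro rfl
    exact ⟨(hp _).2 (Function.isPeriodicPt_minimalPeriod _ _), fun s hs hlt h ↦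
      hlt.not_ge (((hp s).1 h).minimalPeriod_le hs)⟩
  · rintro ⟨h, hmin⟩
    have h' := (hp t).1 h
    refine (h'.minimalPeriod_le ht).antisymm (not_lt.1 fun hlt ↦ ?_)
    exact hmin _ (h'.minimalPeriod_pos ht) hlt ((hp _).2 (Function.isPeriodicPt_minimalPeriod _ _))

lemma Equiv.Perm.dvd_card_of_minimalPeriod_eq {α : Type*} [Finite α] (σ : Equiv.Perm α) {t : ℕ}
    (h : ∀ i, Function.minimalPeriod σ i = t) : t ∣ Nat.card α := by
  classical
  have := Fintype.ofFinite α
  rw [Nat.card_congr (MulAction.selfEquivSigmaOrbits (Subgroup.zpowers σ) α), Nat.card_sigma]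
  refine Finset.dvd_sum fun ω _ ↦ ?_
  rw [Nat.card_eq_fintype_card, ← MulAction.minimalPeriod_eq_card]
  exact (h _).symm.dvd

/-- The sum of `f` over the points lying in `t`-cycles, evaluated at (conjugates of) their
cycle products. -/
noncomputable def Wr.exactPeriodSum (t : ℕ) (f : G → ℂ) (x : Wr G n) : ℂ :=
  ∑ i : Fin n, if Function.minimalPeriod x.right i = t then f ((x ^ t).left i) else 0

lemma Wr.mul_aTC [DecidableEq (ConjClasses G)] {t : ℕ} (ht : 0 < t) (c : ConjClasses G)
    (x : Wr G n) :
    (t : ℂ) * aTC t c x.left x.right =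
      Wr.exactPeriodSum t (fun g ↦ if ConjClasses.mk g = c then 1 else 0) x := by
  let P : Fin n → Prop := fun i ↦
    Function.minimalPeriod x.right i = t ∧ ConjClasses.mk ((x ^ t).left i) = c
  have hP (i : Fin n) : ((x.right ^ t) i = i ∧ (∀ s, 0 < s → s < t → (x.right ^ s) i ≠ i) ∧
      ConjClasses.mk (cycleProd t x.left x.right i) = c) ↔ P i := by
    simp only [P]
    rw [x.right.minimalPeriod_eq_iff ht, and_assoc]
    refine and_congr_right fun hi ↦ ?_
    rw [x.mk_cycleProd hi]
  have hinv (i : Fin n) : P (x.right i) ↔ P i := by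
    simp only [P]
    rw [Function.minimalPeriod_apply (Function.mem_periodicPts.2 ⟨_, orderOf_pos x.right, by
      rw [Function.IsPeriodicPt, Equiv.Perm.iterate_eq_pow, pow_orderOf_eq_one]; rfl⟩)]
    refine and_congr_right fun hi ↦ ?_
    rw [ConjClasses.mk_eq_mk_iff_isConj.2
      (x.isConj_pow_left ((x.right.minimalPeriod_eq_iff ht i).1 hi).1)]
  have hdvd : t ∣ Nat.card {i // P i} := by
    refine (x.right.subtypePerm hinv).dvd_card_of_minimalPeriod_eq fun i ↦ ?_
    rw [Equiv.Perm.minimalPeriod_eq_iff _ ht]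
    simpa [Equiv.Perm.subtypePerm_pow, Subtype.ext_iff] using
      (x.right.minimalPeriod_eq_iff ht _).1 i.2.1
  rw [aTC, Nat.card_congr (Equiv.subtypeEquivRight hP), ← Nat.cast_mul, Nat.mul_div_cancel' hdvd,
    Nat.card_eq_fintype_card, Fintype.card_subtype, Finset.card_filter]
  simp [Wr.exactPeriodSum, P, ite_and]

lemma Wr.sum_fixed_eq_sum_exactPeriodSum {k : ℕ} (hk : 0 < k) (f : G → ℂ) (x : Wr G n) :
    (∑ i : Fin n, if (x ^ k).right i = i then f ((x ^ k).left i) else 0) =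
      ∑ t ∈ k.divisors, Wr.exactPeriodSum t (fun g ↦ f (g ^ (k / t))) x := by
  simp only [Wr.exactPeriodSum]
  rw [Finset.sum_comm]
  refine Finset.sum_congr rfl fun i _ ↦ ?_
  rw [Finset.sum_ite_eq]
  have hiff : (x ^ k).right i = i ↔ Function.minimalPeriod x.right i ∣ k := by
    rw [Wr.pow_right, ← Equiv.Perm.iterate_eq_pow]
    exact Function.isPeriodicPt_iff_minimalPeriod_dvd
  simp only [hiff, Nat.mem_divisors, hk.ne', ne_eq, not_false_eq_true, and_true]
  split_ifs with h
  · have hfix : (x ^ Function.minimalPeriod x.right i).right i = i := by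
      rw [Wr.pow_right, ← Equiv.Perm.iterate_eq_pow]
      exact Function.isPeriodicPt_minimalPeriod _ _
    rw [← Wr.pow_left_of_fixed _ hfix, ← pow_mul, Nat.mul_div_cancel' h]
  · rfl

end Wreath

section Span

variable (G : Type) [Group G] (n : ℕ)

/-- The span of the functions `(Ind φ)^{(m)}` for `m ≤ k` and `φ` an irreducible character. -/
def Wr.indCharSpan (k : ℕ) : Submodule ℂ (Wr G n → ℂ) :=
  Submodule.span ℂ { f : Wr G n → ℂ |
    ∃ m : ℕ, m ≤ k ∧ ∃ V : FDRep ℂ G, Simple V ∧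
      f = fun x : Wr G n =>
        ∑ i : Fin n, if (x ^ m).right i = i then V.character ((x ^ m).left i) else 0 }

lemma Wr.indCharSpan_mono : Monotone (Wr.indCharSpan G n) := by
  intro k l hkl
  refine Submodule.span_mono ?_
  rintro f ⟨m, hm, h⟩
  exact ⟨m, hm.trans hkl, h⟩

variable {G n} [Fintype G]

lemma Wr.sum_fixed_mem_indCharSpan (k : ℕ) {f : G → ℂ} (hf : ∀ g h, f (h * g * h⁻¹) = f g) :
    (fun x : Wr G n ↦ ∑ i : Fin n, if (x ^ k).right i = i then f ((x ^ k).left i) else 0) ∈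
      Wr.indCharSpan G n k := by
  have hf' := FDRep.mem_span_character_of_conj_invariant hf
  clear hf
  induction hf' using Submodule.span_induction with
  | mem χ hχ =>
    obtain ⟨V, hV, rfl⟩ := hχ
    exact Submodule.subset_span ⟨k, le_rfl, V, hV, rfl⟩
  | zero =>
    convert (Wr.indCharSpan G n k).zero_mem using 1
    ext x
    simp
  | add f g _ _ hf hg =>
    convert (Wr.indCharSpan G n k).add_mem hf hg using 1
    ext x
    rw [Pi.add_apply, ← Finset.sum_add_distrib]
    refine Finset.sum_congr rfl fun i _ ↦ ?_
    split_ifs <;> simp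
  | smul r f _ hf =>
    convert (Wr.indCharSpan G n k).smul_mem r hf using 1
    ext x
    simp [Finset.mul_sum]

lemma Wr.exactPeriodSum_mem_indCharSpan {k : ℕ} (hk : 0 < k) {f : G → ℂ}
    (hf : ∀ g h, f (h * g * h⁻¹) = f g) :
    (Wr.exactPeriodSum k f : Wr G n → ℂ) ∈ Wr.indCharSpan G n k := by
  induction k using Nat.strong_induction_on generalizing f with
  | _ k ih =>
    have hsplit : (Wr.exactPeriodSum k f : Wr G n → ℂ) =
        (fun x ↦ ∑ i : Fin n, if (x ^ k).right i = i then f ((x ^ k).left i) else 0) -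
          ∑ t ∈ k.properDivisors, Wr.exactPeriodSum t (fun g ↦ f (g ^ (k / t))) := by
      ext x
      simp only [Pi.sub_apply, Finset.sum_apply]
      rw [Wr.sum_fixed_eq_sum_exactPeriodSum hk, ← Nat.cons_self_properDivisors hk.ne',
        Finset.sum_cons, add_sub_cancel_right, Nat.div_self hk]
      simp
    rw [hsplit]
    refine Submodule.sub_mem _ (Wr.sum_fixed_mem_indCharSpan k hf)
      (Submodule.sum_mem _ fun t ht ↦ ?_)
    have htk := Nat.mem_properDivisors.1 ht
    refine Wr.indCharSpan_mono G n htk.2.le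
      (ih t htk.2 (Nat.pos_of_dvd_of_pos htk.1 hk) fun g h ↦ ?_)
    rw [conj_pow, hf]

end Span

/-- For `1 ≤ k ≤ n` and a conjugacy class `c` of `G`, the class function
`a_{k,c}` on `G ≀ Sₙ` lies in the ℂ-linear span of the functions `(Ind φ)^{(m)}`
for `m ≤ k` and `φ` ranging over the irreducible characters of `G`. -/
theorem stmt10 (G : Type) [Group G] [Fintype G] (n k : ℕ) (hk : 1 ≤ k) (hkn : k ≤ n)
    (c : ConjClasses G) :
    (fun x : Wr G n => (aTC k c x.left x.right : ℂ)) ∈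
      Submodule.span ℂ { f : Wr G n → ℂ |
        ∃ m : ℕ, m ≤ k ∧ ∃ V : FDRep ℂ G, Simple V ∧
          f = fun x : Wr G n =>
            ∑ i : Fin n, if (x ^ m).right i = i then V.character ((x ^ m).left i) else 0 } := by
  classical
  have h := Wr.exactPeriodSum_mem_indCharSpan (n := n) hk
    (f := fun g : G ↦ if ConjClasses.mk g = c then 1 else 0) fun g h ↦ by
      rw [ConjClasses.mk_eq_mk_iff_isConj.2 (isConj_iff.2 ⟨h, rfl⟩ : IsConj g (h * g * h⁻¹))]
  convert! Submodule.smul_mem _ ((k : ℂ)⁻¹) h using 1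
  ext x
  rw [Pi.smul_apply, smul_eq_mul, eq_inv_mul_iff_mul_eq₀ (Nat.cast_ne_zero.2 (Nat.ne_of_gt hk)),
    Wr.mul_aTC hk]
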